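/- Let g(x) = Z(x) − μ(x) be the kriging residual process, A ⊆ Ω a closed deterministic subset with σ_A = sup_{x∈A} σ(x) > 0, and 𝔡 the pseudometric on A defined by 𝔡(x,x') = √(E[(g(x) − g(x'))²]). Let N(ε, A, 𝔡) denote the minimal number of 𝔡-balls of radius ε needed to cover A. Then for every ε > 0: log N(ε, A, 𝔡) ≤ p · log( 48 A₀ D_Ω σ² σ_A² / ε⁴ + 1 ). -/

import Mathlib

open MeasureTheory ProbabilityTheory
open scoped RealInnerProductSpace

noncomputable def kmat {p n : ℕ} (Ψ : EuclideanSpace ℝ (Fin p) → ℝ)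
    (xs : Fin n → EuclideanSpace ℝ (Fin p)) : Matrix (Fin n) (Fin n) ℝ :=
  Matrix.of fun j k => Ψ (xs j - xs k)

noncomputable def kinterp {p n : ℕ} (Ψ : EuclideanSpace ℝ (Fin p) → ℝ)
    (xs : Fin n → EuclideanSpace ℝ (Fin p)) (f : EuclideanSpace ℝ (Fin p) → ℝ)
    (v : EuclideanSpace ℝ (Fin p)) : ℝ :=
  ∑ j, ∑ k, Ψ (v - xs j) * (kmat Ψ xs)⁻¹ j k * f (xs k)

noncomputable def krigSd {p n : ℕ} (Ψ : EuclideanSpace ℝ (Fin p) → ℝ)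
    (xs : Fin n → EuclideanSpace ℝ (Fin p)) (σ : ℝ)
    (v : EuclideanSpace ℝ (Fin p)) : ℝ :=
  σ * Real.sqrt (1 - ∑ j, ∑ k, Ψ (v - xs j) * (kmat Ψ xs)⁻¹ j k * Ψ (v - xs k))

noncomputable def krigRatio {p n : ℕ} (Ψ : EuclideanSpace ℝ (Fin p) → ℝ)
    (xs : Fin n → EuclideanSpace ℝ (Fin p)) (σ : ℝ)
    (f : EuclideanSpace ℝ (Fin p) → ℝ) (v : EuclideanSpace ℝ (Fin p)) : ℝ :=
  (f v - kinterp Ψ xs f v) /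
    (krigSd Ψ xs σ v * Real.sqrt (Real.log (Real.exp 1 * σ / krigSd Ψ xs σ v)))

def GaussCov {p : ℕ} {Ω' : Type*} [MeasurableSpace Ω'] (P : Measure Ω')
    (Z : EuclideanSpace ℝ (Fin p) → Ω' → ℝ) (σ : ℝ)
    (Ψ : EuclideanSpace ℝ (Fin p) → ℝ) : Prop :=
  ∀ (m : ℕ) (c : Fin m → ℝ) (y : Fin m → EuclideanSpace ℝ (Fin p)),
    Measure.map (fun ω' => ∑ i, c i * Z (y i) ω') P =
      gaussianReal 0 (∑ i, ∑ j, c i * c j * (σ ^ 2 * Ψ (y i - y j))).toNNReal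

def IsSpectralDensity {p : ℕ} (Ψ Ψt : EuclideanSpace ℝ (Fin p) → ℝ) : Prop :=
  (∀ ω, 0 ≤ Ψt ω) ∧ Integrable Ψt ∧ ((∫ ω, Ψt ω) = 1) ∧
    ∀ v, Ψ v = ∫ ω, Real.cos ⟪ω, v⟫ * Ψt ω

noncomputable def A0 {p : ℕ} (Ψt : EuclideanSpace ℝ (Fin p) → ℝ) : ℝ :=
  ∫ ω, (∑ i, |ω i|) * Ψt ω

lemma one_sub_cos_le_abs (t : ℝ) : 1 - Real.cos t ≤ |t| := by
  rcases le_or_gt |t| 2 with h | h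
  · have h1 := Real.one_sub_sq_div_two_le_cos (x := t)
    have h2 : t ^ 2 = |t| ^ 2 := (sq_abs t).symm
    nlinarith [abs_nonneg t]
  · linarith [Real.neg_one_le_cos t]

section spec
variable {p : ℕ} {Ψ Ψt : EuclideanSpace ℝ (Fin p) → ℝ}

lemma spec_integrable (h : IsSpectralDensity Ψ Ψt) (v : EuclideanSpace ℝ (Fin p)) :
    Integrable (fun ω => Real.cos ⟪ω, v⟫ * Ψt ω) := by
  refine h.2.1.bdd_mul (c := 1) ?_ ?_
  · exact (by fun_prop : Continuous fun ω : EuclideanSpace ℝ (Fin p) =>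
      Real.cos ⟪ω, v⟫).aestronglyMeasurable
  · exact Filter.Eventually.of_forall fun ω => by
      simpa using Real.abs_cos_le_one _

lemma spec_zero (h : IsSpectralDensity Ψ Ψt) : Ψ 0 = 1 := by
  rw [h.2.2.2]; simpa using h.2.2.1

lemma spec_neg (h : IsSpectralDensity Ψ Ψt) (v : EuclideanSpace ℝ (Fin p)) : Ψ (-v) = Ψ v := by
  rw [h.2.2.2, h.2.2.2]; simp

lemma spec_symm (h : IsSpectralDensity Ψ Ψt) (u v : EuclideanSpace ℝ (Fin p)) :
    Ψ (u - v) = Ψ (v - u) := by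
  rw [← spec_neg h, neg_sub]

lemma spec_ge (h : IsSpectralDensity Ψ Ψt) (v : EuclideanSpace ℝ (Fin p)) : -1 ≤ Ψ v := by
  rw [h.2.2.2, ← h.2.2.1, ← integral_neg]
  refine integral_mono h.2.1.neg (spec_integrable h v) fun ω => ?_
  have := h.1 ω
  have := Real.neg_one_le_cos ⟪ω, v⟫
  simp only [Pi.neg_apply]
  nlinarith

lemma spec_lip (h : IsSpectralDensity Ψ Ψt)
    (hA0 : Integrable (fun ω => (∑ i, |ω i|) * Ψt ω))
    (v : EuclideanSpace ℝ (Fin p)) (M : ℝ) (hM : ∀ i, |v i| ≤ M) :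
    1 - Ψ v ≤ A0 Ψt * M := by
  rw [h.2.2.2, A0, ← h.2.2.1, ← integral_sub h.2.1 (spec_integrable h v), ← integral_mul_const]
  refine integral_mono (h.2.1.sub (spec_integrable h v)) (hA0.mul_const M) fun ω => ?_
  have h0 := h.1 ω
  have h1 := one_sub_cos_le_abs ⟪ω, v⟫
  have h2 : |⟪ω, v⟫| ≤ (∑ i, |ω i|) * M := by
    rw [PiLp.inner_apply, Finset.sum_mul]
    refine (Finset.abs_sum_le_sum_abs _ _).trans (Finset.sum_le_sum fun i _ => ?_)
    simp only [RCLike.inner_apply, conj_trivial, abs_mul]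
    rw [mul_comm]
    exact mul_le_mul_of_nonneg_left (hM i) (abs_nonneg _)
  show Ψt ω - Real.cos ⟪ω, v⟫ * Ψt ω ≤ (∑ i, |ω i|) * Ψt ω * M
  nlinarith [mul_le_mul_of_nonneg_right (h1.trans h2) h0]

lemma A0_nonneg (h : IsSpectralDensity Ψ Ψt) : 0 ≤ A0 Ψt :=
  integral_nonneg fun ω => mul_nonneg (Finset.sum_nonneg fun i _ => abs_nonneg _) (h.1 ω)

end spec

section hilb
variable {p n : ℕ} {H : Type*} [NormedAddCommGroup H] [InnerProductSpace ℝ H]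

noncomputable def hres (Ψ : EuclideanSpace ℝ (Fin p) → ℝ)
    (xs : Fin n → EuclideanSpace ℝ (Fin p)) (z : EuclideanSpace ℝ (Fin p) → H)
    (y : EuclideanSpace ℝ (Fin p)) : H :=
  z y - ∑ j, ∑ k, (Ψ (y - xs j) * (kmat Ψ xs)⁻¹ j k) • z (xs k)

variable {Ψ : EuclideanSpace ℝ (Fin p) → ℝ}
    {xs : Fin n → EuclideanSpace ℝ (Fin p)} {z : EuclideanSpace ℝ (Fin p) → H} {σ : ℝ}

lemma hres_orth (hz : ∀ u v, ⟪z u, z v⟫ = σ ^ 2 * Ψ (u - v))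
    (hK : IsUnit (kmat Ψ xs).det) (y : EuclideanSpace ℝ (Fin p)) (l : Fin n) :
    ⟪hres Ψ xs z y, z (xs l)⟫ = 0 := by
  rw [hres, inner_sub_left, sum_inner, hz, sub_eq_zero]
  have key : ∀ j, ∑ k, (kmat Ψ xs)⁻¹ j k * Ψ (xs k - xs l) = if j = l then 1 else 0 := by
    intro j
    have := congrFun (congrFun (Matrix.nonsing_inv_mul _ hK) j) l
    rw [Matrix.mul_apply, Matrix.one_apply] at this
    exact this
  have : ∀ j, ⟪∑ k, (Ψ (y - xs j) * (kmat Ψ xs)⁻¹ j k) • z (xs k), z (xs l)⟫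
      = σ ^ 2 * Ψ (y - xs j) * if j = l then 1 else 0 := by
    intro j
    rw [← key j, sum_inner, Finset.mul_sum]
    refine Finset.sum_congr rfl fun k _ => ?_
    rw [real_inner_smul_left, hz]; ring
  simp [this]

lemma hres_orth_sum (hz : ∀ u v, ⟪z u, z v⟫ = σ ^ 2 * Ψ (u - v))
    (hK : IsUnit (kmat Ψ xs).det) (y c : EuclideanSpace ℝ (Fin p)) :
    ⟪hres Ψ xs z y, z c - hres Ψ xs z c⟫ = 0 := by
  have : z c - hres Ψ xs z c =
      ∑ j, ∑ k, (Ψ (c - xs j) * (kmat Ψ xs)⁻¹ j k) • z (xs k) := by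
    rw [hres]; abel
  rw [this, inner_sum]
  refine Finset.sum_eq_zero fun j _ => ?_
  rw [inner_sum]
  refine Finset.sum_eq_zero fun k _ => ?_
  rw [real_inner_smul_right, hres_orth hz hK, mul_zero]

lemma hres_norm (hz : ∀ u v, ⟪z u, z v⟫ = σ ^ 2 * Ψ (u - v)) (hσ : 0 < σ)
    (hΨ0 : Ψ 0 = 1) (hsym : ∀ u v, Ψ (u - v) = Ψ (v - u))
    (hK : IsUnit (kmat Ψ xs).det) (y : EuclideanSpace ℝ (Fin p)) :
    ‖hres Ψ xs z y‖ = krigSd Ψ xs σ y := by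
  have h1 : ‖hres Ψ xs z y‖ ^ 2 =
      σ ^ 2 * (1 - ∑ j, ∑ k, Ψ (y - xs j) * (kmat Ψ xs)⁻¹ j k * Ψ (y - xs k)) := by
    have h0 := hres_orth_sum hz hK y y
    rw [inner_sub_right, sub_eq_zero] at h0
    rw [← real_inner_self_eq_norm_sq, ← h0, hres, inner_sub_left, hz, sub_self, hΨ0, sum_inner,
      mul_sub, Finset.mul_sum]
    congr 1
    refine Finset.sum_congr rfl fun j _ => ?_
    rw [sum_inner, Finset.mul_sum]
    refine Finset.sum_congr rfl fun k _ => ?_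
    rw [real_inner_smul_left, hz, hsym (xs k) y]; ring
  rw [krigSd, ← Real.sqrt_sq (norm_nonneg _), h1, Real.sqrt_mul (sq_nonneg _), Real.sqrt_sq hσ.le]

lemma hres_dist (hz : ∀ u v, ⟪z u, z v⟫ = σ ^ 2 * Ψ (u - v))
    (hΨ0 : Ψ 0 = 1) (hsym : ∀ u v, Ψ (u - v) = Ψ (v - u))
    (hK : IsUnit (kmat Ψ xs).det) (y c : EuclideanSpace ℝ (Fin p)) :
    ‖hres Ψ xs z y - hres Ψ xs z c‖ ^ 2 ≤ 2 * σ ^ 2 * (1 - Ψ (y - c)) := by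
  have h1 : ‖z y - z c‖ ^ 2 = 2 * σ ^ 2 * (1 - Ψ (y - c)) := by
    rw [norm_sub_sq_real, ← real_inner_self_eq_norm_sq, ← real_inner_self_eq_norm_sq, hz, hz, hz,
      sub_self, sub_self, hΨ0]; ring
  rw [← h1]
  set a := hres Ψ xs z y with ha
  set b := hres Ψ xs z c with hb
  have e : z y - z c = (a - b) + ((z y - a) - (z c - b)) := by abel
  have o : ⟪a - b, (z y - a) - (z c - b)⟫ = 0 := by
    have o1 : ⟪a, z y - a⟫ = 0 := hres_orth_sum hz hK y y
    have o2 : ⟪a, z c - b⟫ = 0 := hres_orth_sum hz hK y c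
    have o3 : ⟪b, z y - a⟫ = 0 := hres_orth_sum hz hK c y
    have o4 : ⟪b, z c - b⟫ = 0 := hres_orth_sum hz hK c c
    rw [inner_sub_left, inner_sub_right a, inner_sub_right b, o1, o2, o3, o4]; simp
  rw [e, norm_add_sq_real, o]
  nlinarith [sq_nonneg ‖(z y - a) - (z c - b)‖]

end hilb

section prob
variable {p : ℕ} {Ψ Ψt : EuclideanSpace ℝ (Fin p) → ℝ} {Ω' : Type*} [MeasurableSpace Ω']
  {P : Measure Ω'} {Z : EuclideanSpace ℝ (Fin p) → Ω' → ℝ} {σ : ℝ}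

lemma gauss_sq {X : Ω' → ℝ} (hX : Measurable X) {v : NNReal}
    (h : Measure.map X P = gaussianReal 0 v) : MemLp X 2 P ∧ ∫ ω, X ω ^ 2 ∂P = v := by
  have hm : MemLp id 2 (gaussianReal 0 v) := memLp_id_gaussianReal 2
  constructor
  · rw [← h] at hm
    exact (memLp_map_measure_iff (by fun_prop) hX.aemeasurable).1 hm
  · have h1 : ∫ x, x ^ 2 ∂(Measure.map X P) = ∫ ω, X ω ^ 2 ∂P :=
      integral_map hX.aemeasurable (by fun_prop)
    rw [← h1, h]
    have h2 := variance_id_gaussianReal (μ := 0) (v := v)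
    rw [variance_eq_integral (by fun_prop)] at h2
    simpa using h2

lemma Z_memLp (hZmeas : ∀ x, Measurable (Z x)) (hg : GaussCov P Z σ Ψ)
    (u : EuclideanSpace ℝ (Fin p)) : MemLp (Z u) 2 P := by
  have := hg 1 (fun _ => 1) (fun _ => u)
  simp only [Fin.sum_univ_one, one_mul] at this
  exact (gauss_sq (hZmeas u) this).1

lemma Z_cov (h : IsSpectralDensity Ψ Ψt) (hZmeas : ∀ x, Measurable (Z x))
    (hg : GaussCov P Z σ Ψ)
    (u v : EuclideanSpace ℝ (Fin p)) : ∫ ω, Z u ω * Z v ω ∂P = σ ^ 2 * Ψ (u - v) := by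
  have hone : ∀ u, ∫ ω, Z u ω ^ 2 ∂P = σ ^ 2 := by
    intro u
    have := hg 1 (fun _ => 1) (fun _ => u)
    simp only [Fin.sum_univ_one, one_mul, sub_self, spec_zero h, mul_one] at this
    rw [(gauss_sq (hZmeas u) this).2, Real.coe_toNNReal _ (sq_nonneg _)]
  have h2 := hg 2 (fun _ => 1) ![u, v]
  simp only [Fin.sum_univ_two, one_mul, Matrix.cons_val_zero, Matrix.cons_val_one, sub_self,
    spec_zero h, mul_one] at h2
  have h3 := (gauss_sq ((hZmeas u).add (hZmeas v)) h2).2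
  rw [Real.coe_toNNReal _ (by
    have := spec_ge h (u - v); have := spec_ge h (v - u); have := sq_nonneg σ; nlinarith),
    spec_symm h v u] at h3
  have iu := Z_memLp hZmeas hg u
  have iv := Z_memLp hZmeas hg v
  have iuv : Integrable (fun ω => Z u ω * Z v ω) P := iu.integrable_mul iv
  have h4 : ∫ ω, (Z u ω + Z v ω) ^ 2 ∂P =
      ∫ ω, Z u ω ^ 2 ∂P + 2 * ∫ ω, Z u ω * Z v ω ∂P + ∫ ω, Z v ω ^ 2 ∂P := by
    rw [← integral_const_mul, ← integral_add iu.integrable_sq (iuv.const_mul 2),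
      ← integral_add (f := fun ω => Z u ω ^ 2 + 2 * (Z u ω * Z v ω))
        (iu.integrable_sq.add (iuv.const_mul 2)) iv.integrable_sq]
    congr 1; ext ω; ring
  rw [hone, hone] at h4
  have h5 : ∫ ω, (Z u ω + Z v ω) ^ 2 ∂P = _ := h3
  linarith

end prob

section bridge
variable {p n : ℕ} {Ω' : Type*} [MeasurableSpace Ω'] {P : Measure Ω'}

lemma coe_finset_sum {ι : Type*} (s : Finset ι) (f : ι → Lp ℝ 2 P) (F : ι → Ω' → ℝ)
    (h : ∀ i, f i =ᵐ[P] F i) : (∑ i ∈ s, f i : Lp ℝ 2 P) =ᵐ[P] fun ω => ∑ i ∈ s, F i ω := by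
  classical
  induction s using Finset.induction_on with
  | empty =>
    filter_upwards [Lp.coeFn_zero ℝ 2 P] with ω h1
    simpa using h1
  | insert a s ha ih =>
    rw [Finset.sum_insert ha]
    filter_upwards [Lp.coeFn_add (f a) (∑ i ∈ s, f i), ih, h a] with ω h1 h2 h3
    rw [h1, Pi.add_apply, h2, h3, Finset.sum_insert ha]

lemma hres_coe {Ψ : EuclideanSpace ℝ (Fin p) → ℝ}
    {xs : Fin n → EuclideanSpace ℝ (Fin p)} {Z : EuclideanSpace ℝ (Fin p) → Ω' → ℝ}
    (hm : ∀ u, MemLp (Z u) 2 P) (y : EuclideanSpace ℝ (Fin p)) :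
    (hres Ψ xs (fun u => (hm u).toLp (Z u)) y : Lp ℝ 2 P) =ᵐ[P]
      fun ω => Z y ω - kinterp Ψ xs (fun w => Z w ω) y := by
  have hs := coe_finset_sum (P := P) Finset.univ
    (fun j => ∑ k, (Ψ (y - xs j) * (kmat Ψ xs)⁻¹ j k) • (hm (xs k)).toLp (Z (xs k)))
    (fun j ω => ∑ k, Ψ (y - xs j) * (kmat Ψ xs)⁻¹ j k * Z (xs k) ω)
    (fun j => coe_finset_sum (P := P) Finset.univ _ _ (fun k => by
      filter_upwards [Lp.coeFn_smul (Ψ (y - xs j) * (kmat Ψ xs)⁻¹ j k)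
        ((hm (xs k)).toLp (Z (xs k))), (hm (xs k)).coeFn_toLp] with ω h1 h2
      rw [h1, Pi.smul_apply, h2, smul_eq_mul]))
  unfold hres
  filter_upwards [Lp.coeFn_sub ((hm y).toLp (Z y))
    (∑ j, ∑ k, (Ψ (y - xs j) * (kmat Ψ xs)⁻¹ j k) • (hm (xs k)).toLp (Z (xs k))), hs,
    (hm y).coeFn_toLp] with ω h1 h2 h3
  rw [h1, Pi.sub_apply, h2, h3, kinterp]

lemma Lp_norm_sq (f : Lp ℝ 2 P) (F : Ω' → ℝ) (h : f =ᵐ[P] F) :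
    ∫ ω, F ω ^ 2 ∂P = ‖f‖ ^ 2 := by
  rw [← real_inner_self_eq_norm_sq, L2.inner_def]
  refine integral_congr_ae ?_
  filter_upwards [h] with ω hω
  simp [hω, sq]

end bridge

/-- Grid covering: `A` splits into at most `(κ D + 1) ^ p` cells. -/
lemma grid_cover {p : ℕ} (A : Set (EuclideanSpace ℝ (Fin p))) (D κ : ℝ) (hκ : 0 ≤ κ)
    (hD0 : 0 ≤ D) (hA : A.Nonempty) (hD : ∀ x ∈ A, ∀ y ∈ A, dist x y ≤ D) :
    ∃ s : Finset (EuclideanSpace ℝ (Fin p)), ↑s ⊆ A ∧ s.Nonempty ∧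
      (∀ y ∈ A, ∃ c ∈ s, ∀ i, κ * |y i - c i| ≤ 1) ∧ (s.card : ℝ) ≤ (κ * D + 1) ^ p := by
  classical
  have hco : ∀ x ∈ A, ∀ y ∈ A, ∀ i, x i - y i ≤ D := by
    intro x hx y hy i
    have h1 : |x i - y i| ≤ dist x y := by
      rw [dist_eq_norm]
      simpa using PiLp.norm_apply_le (x - y) i
    exact (le_abs_self _).trans (h1.trans (hD x hx y hy))
  obtain ⟨x0, hx0⟩ := hA
  set m : Fin p → ℝ := fun i => sInf ((fun x : EuclideanSpace ℝ (Fin p) => x i) '' A) with hm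
  have hbdd : ∀ i, BddBelow ((fun x : EuclideanSpace ℝ (Fin p) => x i) '' A) := by
    intro i
    refine ⟨x0 i - D, ?_⟩
    rintro _ ⟨y, hy, rfl⟩
    have := hco x0 hx0 y hy i
    simp only; linarith
  have hm1 : ∀ x ∈ A, ∀ i, 0 ≤ x i - m i := fun x hx i =>
    sub_nonneg.2 (csInf_le (hbdd i) ⟨x, hx, rfl⟩)
  have hm2 : ∀ x ∈ A, ∀ i, x i - m i ≤ D := by
    intro x hx i
    have : x i - D ≤ m i := by
      refine le_csInf ⟨_, x0, hx0, rfl⟩ ?_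
      rintro _ ⟨y, hy, rfl⟩
      have := hco x hx y hy i
      simp only; linarith
    linarith
  set f : EuclideanSpace ℝ (Fin p) → (Fin p → ℕ) := fun x i => ⌊κ * (x i - m i)⌋₊ with hf
  set T : Finset (Fin p → ℕ) := Fintype.piFinset fun _ => Finset.range (⌊κ * D⌋₊ + 1) with hT
  have hfT : ∀ x ∈ A, f x ∈ T := by
    intro x hx
    rw [hT, Fintype.mem_piFinset]
    intro i
    rw [Finset.mem_range, Nat.lt_succ_iff]
    exact Nat.floor_le_floor (mul_le_mul_of_nonneg_left (hm2 x hx i) hκ)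
  have hfin : (f '' A).Finite := T.finite_toSet.subset (by
    rintro _ ⟨x, hx, rfl⟩; exact hfT x hx)
  have hch : ∀ t, ∃ x, t ∈ f '' A → x ∈ A ∧ f x = t := by
    intro t
    by_cases h : t ∈ f '' A
    · obtain ⟨x, hx, e⟩ := h; exact ⟨x, fun _ => ⟨hx, e⟩⟩
    · exact ⟨x0, fun h' => absurd h' h⟩
  choose g hg using hch
  refine ⟨hfin.toFinset.image g, ?_, ?_, ?_, ?_⟩
  · intro x hx
    simp only [Finset.coe_image, Set.Finite.coe_toFinset] at hx
    obtain ⟨t, ht, rfl⟩ := hx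
    exact (hg t ht).1
  · exact ⟨g (f x0), Finset.mem_image_of_mem _ (by simpa using ⟨x0, hx0, rfl⟩)⟩
  · intro y hy
    have hfy : f y ∈ f '' A := ⟨y, hy, rfl⟩
    refine ⟨g (f y), Finset.mem_image_of_mem _ (by simpa using ⟨y, hy, rfl⟩), fun i => ?_⟩
    obtain ⟨hc, he⟩ := hg _ hfy
    set c := g (f y)
    have e : ⌊κ * (c i - m i)⌋₊ = ⌊κ * (y i - m i)⌋₊ := congrFun he i
    have a1 := Nat.floor_le (mul_nonneg hκ (hm1 c hc i))
    have a2 := Nat.lt_floor_add_one (κ * (c i - m i))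
    have b1 := Nat.floor_le (mul_nonneg hκ (hm1 y hy i))
    have b2 := Nat.lt_floor_add_one (κ * (y i - m i))
    rw [e] at a1 a2
    rw [← abs_of_nonneg hκ, ← abs_mul, abs_le]
    constructor <;> nlinarith
  · have h1 : (hfin.toFinset.image g).card ≤ T.card :=
      Finset.card_image_le.trans (Finset.card_le_card (by
        intro t ht
        rw [Set.Finite.mem_toFinset] at ht
        obtain ⟨x, hx, rfl⟩ := ht
        exact hfT x hx))
    have h2 : T.card = (⌊κ * D⌋₊ + 1) ^ p := by simp [hT]
    rw [h2] at h1
    calc ((hfin.toFinset.image g).card : ℝ) ≤ ((⌊κ * D⌋₊ + 1) ^ p : ℕ) := by exact_mod_cast h1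
      _ ≤ (κ * D + 1) ^ p := by
        push_cast
        gcongr
        exact Nat.floor_le (mul_nonneg hκ hD0)

/-- Covering-number bound (eq:entropyBoundC1) in the proof of Theorem 3 of the paper:
for the pseudometric `𝔡(x,x') = √(E[(g(x) − g(x'))²])` of the kriging residual process
`g = Z − μ` on a closed deterministic subset `A ⊆ Ω` with `σ_A = sup_{x∈A} σ(x) > 0`,
the covering number satisfies `log N(ε, A, 𝔡) ≤ p log(48 A₀ D_Ω σ² σ_A²/ε⁴ + 1)` for all
ε > 0 (rendered: there is an internal ε-cover whose cardinality has logarithm at most the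
stated bound). -/
theorem stmt15 (p : ℕ) (hp : 0 < p)
    (Ω : Set (EuclideanSpace ℝ (Fin p))) (hΩc : IsCompact Ω) (hΩne : Ω.Nonempty)
    (hΩd : 0 < Metric.diam Ω)
    (Ψ Ψt : EuclideanSpace ℝ (Fin p) → ℝ) (hspec : IsSpectralDensity Ψ Ψt)
    (hA0 : Integrable (fun ω => (∑ i, |ω i|) * Ψt ω))
    (σ : ℝ) (hσ : 0 < σ)
    (Ω' : Type) [MeasurableSpace Ω'] (P : Measure Ω') [IsProbabilityMeasure P]
    (Z : EuclideanSpace ℝ (Fin p) → Ω' → ℝ) (hZmeas : ∀ x, Measurable (Z x))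
    (hgauss : GaussCov P Z σ Ψ)
    (n : ℕ) (xs : Fin n → EuclideanSpace ℝ (Fin p)) (hxs : ∀ i, xs i ∈ Ω)
    (hK : IsUnit (kmat Ψ xs).det)
    (A : Set (EuclideanSpace ℝ (Fin p))) (hAcl : IsClosed A) (hAΩ : A ⊆ Ω)
    (σA : ℝ) (hσA : σA = ⨆ v : A, krigSd Ψ xs σ v) (hσApos : 0 < σA)
    (ε : ℝ) (hε : 0 < ε) :
    ∃ s : Finset (EuclideanSpace ℝ (Fin p)), ↑s ⊆ A ∧
      (A ⊆ ⋃ c ∈ s, {y : EuclideanSpace ℝ (Fin p) |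
        Real.sqrt (∫ ω', ((Z y ω' - kinterp Ψ xs (fun w => Z w ω') y) -
          (Z c ω' - kinterp Ψ xs (fun w => Z w ω') c)) ^ 2 ∂P) ≤ ε}) ∧
      Real.log s.card ≤
        p * Real.log (48 * A0 Ψt * Metric.diam Ω * σ ^ 2 * σA ^ 2 / ε ^ 4 + 1) := by

  have hZ := Z_memLp hZmeas hgauss
  set z : EuclideanSpace ℝ (Fin p) → Lp ℝ 2 P := fun u => (hZ u).toLp (Z u) with hzdef
  have hz : ∀ u v, ⟪z u, z v⟫ = σ ^ 2 * Ψ (u - v) := by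
    intro u v
    rw [← Z_cov hspec hZmeas hgauss u v, L2.inner_def]
    refine integral_congr_ae ?_
    filter_upwards [(hZ u).coeFn_toLp, (hZ v).coeFn_toLp] with ω h1 h2
    simp [hzdef, h1, h2, mul_comm]
  have hΨ0 := spec_zero hspec
  have hsym := spec_symm hspec
  have hd : ∀ y c, ∫ ω', ((Z y ω' - kinterp Ψ xs (fun w => Z w ω') y) -
          (Z c ω' - kinterp Ψ xs (fun w => Z w ω') c)) ^ 2 ∂P
        = ‖hres Ψ xs z y - hres Ψ xs z c‖ ^ 2 := by
    intro y c
    refine Lp_norm_sq _ _ ?_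
    filter_upwards [Lp.coeFn_sub (hres Ψ xs z y) (hres Ψ xs z c),
      hres_coe (Ψ := Ψ) (xs := xs) hZ y, hres_coe (Ψ := Ψ) (xs := xs) hZ c] with ω h1 h2 h3
    rw [h1, Pi.sub_apply, h2, h3]
  have hbdd : BddAbove (Set.range fun v : A => krigSd Ψ xs σ v) := by
    by_contra h
    rw [hσA, Real.iSup_of_not_bddAbove h] at hσApos
    exact lt_irrefl _ hσApos
  have hle : ∀ y ∈ A, ‖hres Ψ xs z y‖ ≤ σA := by
    intro y hy
    rw [hres_norm hz hσ hΨ0 hsym hK y, hσA]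
    exact le_ciSup hbdd ⟨y, hy⟩
  have hAne : A.Nonempty := by
    by_contra h
    have : IsEmpty A := Set.isEmpty_coe_sort.2 (Set.not_nonempty_iff_eq_empty.1 h)
    rw [hσA, Real.iSup_of_isEmpty] at hσApos
    exact lt_irrefl _ hσApos
  have hA0n := A0_nonneg hspec
  set κ : ℝ := 8 * A0 Ψt * σ ^ 2 * σA ^ 2 / ε ^ 4 with hκdef
  have hκ : 0 ≤ κ := by positivity
  obtain ⟨s, hsA, hsne, hcov, hcard⟩ := grid_cover A (Metric.diam Ω) κ hκ hΩd.le hAne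
    (fun x hx y hy => Metric.dist_le_diam_of_mem hΩc.isBounded (hAΩ hx) (hAΩ hy))
  refine ⟨s, hsA, ?_, ?_⟩
  · intro y hy
    obtain ⟨c, hcs, hc⟩ := hcov y hy
    simp only [Set.mem_iUnion, Set.mem_setOf_eq]
    refine ⟨c, hcs, ?_⟩
    rw [hd, Real.sqrt_sq (norm_nonneg _)]
    have : Nonempty (Fin p) := ⟨⟨0, hp⟩⟩
    obtain ⟨i0, hi0⟩ := Finite.exists_max (fun i => |(y - c) i|)
    have h1 := hres_dist hz hΨ0 hsym hK y c (xs := xs)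
    have h2 := spec_lip hspec hA0 (y - c) _ hi0
    have h3 := hc i0
    have h4 : ‖hres Ψ xs z y - hres Ψ xs z c‖ ≤ 2 * σA := by
      have := norm_sub_le (hres Ψ xs z y) (hres Ψ xs z c)
      linarith [hle y hy, hle c (hsA hcs)]
    have e : (y - c) i0 = y i0 - c i0 := rfl
    rw [e] at h2
    set d := ‖hres Ψ xs z y - hres Ψ xs z c‖
    set M := |y i0 - c i0|
    have hd0 : 0 ≤ d := norm_nonneg _
    have h5 : d ^ 2 ≤ 2 * σ ^ 2 * (A0 Ψt * M) :=
      h1.trans (mul_le_mul_of_nonneg_left h2 (by positivity))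
    have h6 : d ^ 2 ≤ (2 * σA) ^ 2 := pow_le_pow_left₀ hd0 h4 2
    have h7 : κ * M * ε ^ 4 = 8 * A0 Ψt * σ ^ 2 * σA ^ 2 * M := by
      rw [hκdef]; field_simp
    have h8 : d ^ 4 ≤ ε ^ 4 := by
      calc d ^ 4 = d ^ 2 * d ^ 2 := by ring
        _ ≤ (2 * σ ^ 2 * (A0 Ψt * M)) * (2 * σA) ^ 2 :=
          mul_le_mul h5 h6 (sq_nonneg _) (by positivity)
        _ = κ * M * ε ^ 4 := by rw [h7]; ring
        _ ≤ 1 * ε ^ 4 := mul_le_mul_of_nonneg_right h3 (by positivity)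
        _ = ε ^ 4 := one_mul _
    exact le_of_pow_le_pow_left₀ (by norm_num) hε.le h8
  · rw [← Real.log_pow]
    refine Real.log_le_log (by exact_mod_cast hsne.card_pos) (hcard.trans ?_)
    refine pow_le_pow_left₀ (by positivity) ?_ p
    have : 48 * A0 Ψt * Metric.diam Ω * σ ^ 2 * σA ^ 2 / ε ^ 4 = 6 * (κ * Metric.diam Ω) := by
      rw [hκdef]; ring
    rw [this]
    have : 0 ≤ κ * Metric.diam Ω := by positivity
    linarith
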